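/- Let Y_{ab} be a smooth Yano tensor of rank two on U. Then Y anticommutes with the Ricci tensor in the sense that Y_{ma}R^m_b + Y_{mb}R^m_a = 0 for all a,b, where R_{ab} := R^m_{amb} is the Ricci tensor of Γ and R^m_b := g^{mn}R_{nb}. -/

import Mathlib

/-!
STATEMENT 5: A Yano tensor of rank two anticommutes with the Ricci tensor:
`Y_{ma}R^m_b + Y_{mb}R^m_a = 0`.
-/

noncomputable section

abbrev Pt : Type := Fin 4 → ℝ

/-- Partial derivative of a scalar field in the `c`-th coordinate direction. -/
def pd (f : Pt → ℝ) (c : Fin 4) (p : Pt) : ℝ := fderiv ℝ f p (Pi.single c 1)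

/-- Covariant derivative `∇_c X_a` of a covector field. -/
def covVec (Γ : Fin 4 → Fin 4 → Fin 4 → Pt → ℝ) (X : Fin 4 → Pt → ℝ)
    (c a : Fin 4) (p : Pt) : ℝ :=
  pd (X a) c p - ∑ m, Γ m c a p * X m p

/-- Covariant derivative `∇_c Y_{ab}` of a (0,2)-tensor field. -/
def cov2 (Γ : Fin 4 → Fin 4 → Fin 4 → Pt → ℝ) (Y : Fin 4 → Fin 4 → Pt → ℝ)
    (c a b : Fin 4) (p : Pt) : ℝ :=
  pd (Y a b) c p - ∑ m, Γ m c a p * Y m b p - ∑ m, Γ m c b p * Y a m p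

/-- Sign of `(a,b,c,d)` as a permutation of `(0,1,2,3)`; `0` if indices repeat. -/
def sgn4 (a b c d : Fin 4) : ℝ :=
  let v : Fin 4 → ℝ := ![(a.1 : ℝ), (b.1 : ℝ), (c.1 : ℝ), (d.1 : ℝ)]
  ∏ i : Fin 4, ∏ j : Fin 4, if i < j then (v j - v i) / ((j.1 : ℝ) - (i.1 : ℝ)) else 1

/-- The volume tensor `ε_{abcd} = √(−det g)·sgn(abcd)`. -/
def eps (g : Fin 4 → Fin 4 → Pt → ℝ) (a b c d : Fin 4) (p : Pt) : ℝ :=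
  Real.sqrt (-(Matrix.det (Matrix.of fun i j => g i j p))) * sgn4 a b c d

/-- The curvature tensor `R^m_{acd}` of the connection `Γ`. -/
def Riem (Γ : Fin 4 → Fin 4 → Fin 4 → Pt → ℝ) (m a c d : Fin 4) (p : Pt) : ℝ :=
  pd (Γ m d a) c p - pd (Γ m c a) d p
    + ∑ n, Γ m c n p * Γ n d a p - ∑ n, Γ m d n p * Γ n c a p

/-- The Ricci tensor `R_{ab} = R^m_{amb}`. -/
def Ric (Γ : Fin 4 → Fin 4 → Fin 4 → Pt → ℝ) (a b : Fin 4) (p : Pt) : ℝ :=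
  ∑ m, Riem Γ m a m b p

/-- The mixed Ricci tensor `R^m_b = g^{mn} R_{nb}`. -/
def RicUp (Γ : Fin 4 → Fin 4 → Fin 4 → Pt → ℝ) (ginv : Fin 4 → Fin 4 → Pt → ℝ)
    (m b : Fin 4) (p : Pt) : ℝ :=
  ∑ n, ginv m n p * Ric Γ n b p

lemma pd_congr {U : Set Pt} (hU : IsOpen U) {f h : Pt → ℝ} (hfh : ∀ p ∈ U, f p = h p)
    (c : Fin 4) {p : Pt} (hp : p ∈ U) : pd f c p = pd h c p := by
  have : f =ᶠ[nhds p] h := Filter.eventuallyEq_of_mem (hU.mem_nhds hp) hfh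
  simp only [pd, this.fderiv_eq]

lemma pd_neg (f : Pt → ℝ) (c : Fin 4) (p : Pt) : pd (fun q => -f q) c p = -pd f c p := by
  simp [pd, fderiv_fun_neg]

lemma pd_sub {f h : Pt → ℝ} {p : Pt} (hf : DifferentiableAt ℝ f p) (hh : DifferentiableAt ℝ h p)
    (c : Fin 4) : pd (fun q => f q - h q) c p = pd f c p - pd h c p := by
  simp [pd, fderiv_fun_sub hf hh]

lemma pd_sum_mul {f h : Fin 4 → Pt → ℝ} {p : Pt} (hf : ∀ m, DifferentiableAt ℝ (f m) p)
    (hh : ∀ m, DifferentiableAt ℝ (h m) p) (c : Fin 4) :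
    pd (fun q => ∑ m, f m q * h m q) c p
      = ∑ m, (pd (f m) c p * h m p + f m p * pd (h m) c p) := by
  unfold pd
  rw [fderiv_fun_sum fun m _ => (hf m).fun_mul (hh m)]
  simp only [sum_apply]
  refine Finset.sum_congr rfl fun m _ => ?_
  rw [fderiv_fun_mul (hf m) (hh m)]
  simp only [add_apply, smul_apply, smul_eq_mul]
  ring

lemma differentiableAt_of_smooth {U : Set Pt} (hU : IsOpen U) {f : Pt → ℝ}
    (hf : ContDiffOn ℝ (⊤ : ℕ∞) f U) {p : Pt} (hp : p ∈ U) : DifferentiableAt ℝ f p :=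
  (hf.contDiffAt (hU.mem_nhds hp)).differentiableAt (by simp)

lemma differentiableAt_fderiv_of_smooth {U : Set Pt} (hU : IsOpen U) {f : Pt → ℝ}
    (hf : ContDiffOn ℝ (⊤ : ℕ∞) f U) {p : Pt} (hp : p ∈ U) :
    DifferentiableAt ℝ (fderiv ℝ f) p :=
  ((hf.contDiffAt (hU.mem_nhds hp)).fderiv_right (m := 1)
    (by rw [one_add_one_eq_two]; exact WithTop.coe_le_coe.2 (le_top (a := 2)))).differentiableAt (by simp)

lemma differentiableAt_pd {U : Set Pt} (hU : IsOpen U) {f : Pt → ℝ}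
    (hf : ContDiffOn ℝ (⊤ : ℕ∞) f U) (c : Fin 4) {p : Pt} (hp : p ∈ U) :
    DifferentiableAt ℝ (pd f c) p :=
  (differentiableAt_fderiv_of_smooth hU hf hp).clm_apply (differentiableAt_const _)

lemma pd_comm {U : Set Pt} (hU : IsOpen U) {f : Pt → ℝ}
    (hf : ContDiffOn ℝ (⊤ : ℕ∞) f U) (c d : Fin 4) {p : Pt} (hp : p ∈ U) :
    pd (pd f c) d p = pd (pd f d) c p := by
  have key : ∀ c d, pd (pd f c) d p
      = fderiv ℝ (fderiv ℝ f) p (Pi.single d 1) (Pi.single c 1) := fun c d => by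
    change fderiv ℝ (fun q => fderiv ℝ f q (Pi.single c 1)) p (Pi.single d 1) = _
    rw [fderiv_clm_apply (differentiableAt_fderiv_of_smooth hU hf hp) (differentiableAt_const _)]
    simp
  rw [key, key]
  exact (hf.contDiffAt (hU.mem_nhds hp)).isSymmSndFDerivAt
    (by simp only [minSmoothness_of_isRCLikeNormedField]; exact WithTop.coe_le_coe.2 (le_top (a := 2))) _ _

/-- Covariant derivative `∇_d T_{cba}` of a (0,3)-tensor field. -/
def cov3 (Γ : Fin 4 → Fin 4 → Fin 4 → Pt → ℝ) (T : Fin 4 → Fin 4 → Fin 4 → Pt → ℝ)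
    (d c b a : Fin 4) (p : Pt) : ℝ :=
  pd (T c b a) d p - ∑ m, Γ m d c p * T m b a p - ∑ m, Γ m d b p * T c m a p
    - ∑ m, Γ m d a p * T c b m p

lemma cov3_swap_left {U : Set Pt} (hU : IsOpen U) (Γ : Fin 4 → Fin 4 → Fin 4 → Pt → ℝ)
    {T : Fin 4 → Fin 4 → Fin 4 → Pt → ℝ} (hT : ∀ c b a, ∀ p ∈ U, T c b a p = -T b c a p)
    (d c b a : Fin 4) {p : Pt} (hp : p ∈ U) : cov3 Γ T d c b a p = -cov3 Γ T d b c a p := by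
  have h1 : ∀ k, Γ k d c p * T k b a p = -(Γ k d c p * T b k a p) := fun k => by
    rw [hT k b a p hp]; ring
  have h2 : ∀ k, Γ k d b p * T c k a p = -(Γ k d b p * T k c a p) := fun k => by
    rw [hT c k a p hp]; ring
  have h3 : ∀ k, Γ k d a p * T c b k p = -(Γ k d a p * T b c k p) := fun k => by
    rw [hT c b k p hp]; ring
  simp only [cov3, pd_congr hU (hT c b a) d hp, pd_neg, h1, h2, h3, Finset.sum_neg_distrib]
  ring

lemma cov3_swap_right {U : Set Pt} (hU : IsOpen U) (Γ : Fin 4 → Fin 4 → Fin 4 → Pt → ℝ)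
    {T : Fin 4 → Fin 4 → Fin 4 → Pt → ℝ} (hT : ∀ c b a, ∀ p ∈ U, T c b a p = -T c a b p)
    (d c b a : Fin 4) {p : Pt} (hp : p ∈ U) : cov3 Γ T d c b a p = -cov3 Γ T d c a b p := by
  have h1 : ∀ k, Γ k d c p * T k b a p = -(Γ k d c p * T k a b p) := fun k => by
    rw [hT k b a p hp]; ring
  have h2 : ∀ k, Γ k d b p * T c k a p = -(Γ k d b p * T c a k p) := fun k => by
    rw [hT c k a p hp]; ring
  have h3 : ∀ k, Γ k d a p * T c b k p = -(Γ k d a p * T c k b p) := fun k => by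
    rw [hT c b k p hp]; ring
  simp only [cov3, pd_congr hU (hT c b a) d hp, pd_neg, h1, h2, h3, Finset.sum_neg_distrib]
  ring

lemma pd_cov2 {U : Set Pt} (hU : IsOpen U) {Γ : Fin 4 → Fin 4 → Fin 4 → Pt → ℝ}
    (hΓ : ∀ m a b, ContDiffOn ℝ (⊤ : ℕ∞) (Γ m a b) U) {Y : Fin 4 → Fin 4 → Pt → ℝ}
    (hY : ∀ a b, ContDiffOn ℝ (⊤ : ℕ∞) (Y a b) U) (d c b a : Fin 4) {p : Pt} (hp : p ∈ U) :
    pd (cov2 Γ Y c b a) d p = pd (pd (Y b a) c) d p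
      - ∑ m, (pd (Γ m c b) d p * Y m a p + Γ m c b p * pd (Y m a) d p)
      - ∑ m, (pd (Γ m c a) d p * Y b m p + Γ m c a p * pd (Y b m) d p) := by
  have hΓ' := fun m a b => differentiableAt_of_smooth hU (hΓ m a b) hp
  have hY' := fun a b => differentiableAt_of_smooth hU (hY a b) hp
  have h1 := DifferentiableAt.fun_sum (u := Finset.univ) fun m _ => (hΓ' m c b).fun_mul (hY' m a)
  have h2 := DifferentiableAt.fun_sum (u := Finset.univ) fun m _ => (hΓ' m c a).fun_mul (hY' b m)
  have h0 := differentiableAt_pd hU (hY b a) c hp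
  have := pd_sub (h0.fun_sub h1) h2 d
  rw [pd_sub h0 h1, pd_sum_mul (fun m => hΓ' m c b) (fun m => hY' m a),
    pd_sum_mul (fun m => hΓ' m c a) (fun m => hY' b m)] at this
  exact this

/-- The Ricci identity for (0,2)-tensor fields and a torsion-free connection. -/
lemma ricci_identity {U : Set Pt} (hU : IsOpen U) {Γ : Fin 4 → Fin 4 → Fin 4 → Pt → ℝ}
    (hΓ : ∀ m a b, ContDiffOn ℝ (⊤ : ℕ∞) (Γ m a b) U)
    (hΓsymm : ∀ m a b, ∀ p ∈ U, Γ m a b p = Γ m b a p) {Y : Fin 4 → Fin 4 → Pt → ℝ}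
    (hY : ∀ a b, ContDiffOn ℝ (⊤ : ℕ∞) (Y a b) U) (d c b a : Fin 4) {p : Pt} (hp : p ∈ U) :
    cov3 Γ (cov2 Γ Y) d c b a p - cov3 Γ (cov2 Γ Y) c d b a p
      = -(∑ m, Riem Γ m b d c p * Y m a p) - ∑ m, Riem Γ m a d c p * Y b m p := by
  simp only [cov3, pd_cov2 hU hΓ hY _ _ _ _ hp, pd_comm hU (hY b a) c d hp,
    fun m => hΓsymm m d c p hp]
  simp only [cov2, Riem, Fin.sum_univ_four]
  ring

lemma riem_swap (Γ : Fin 4 → Fin 4 → Fin 4 → Pt → ℝ) (m a c d : Fin 4) (p : Pt) :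
    Riem Γ m a c d p = -Riem Γ m a d c p := by
  simp only [Riem]
  ring

/-- The first Bianchi identity. -/
lemma riem_cyclic {U : Set Pt} (hU : IsOpen U) {Γ : Fin 4 → Fin 4 → Fin 4 → Pt → ℝ}
    (hΓsymm : ∀ m a b, ∀ p ∈ U, Γ m a b p = Γ m b a p) (m a c d : Fin 4) {p : Pt} (hp : p ∈ U) :
    Riem Γ m a c d p + Riem Γ m c d a p + Riem Γ m d a c p = 0 := by
  simp only [Riem, pd_congr hU (hΓsymm m d a) c hp, pd_congr hU (hΓsymm m c a) d hp,
    pd_congr hU (hΓsymm m d c) a hp, fun n => hΓsymm n d a p hp, fun n => hΓsymm n c a p hp,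
    fun n => hΓsymm n d c p hp]
  ring

/-- Pair symmetry follows from the two antisymmetries and the cyclic identity. -/
lemma pair_symm_of_cyclic {ι : Type*} {L : ι → ι → ι → ι → ℝ}
    (h12 : ∀ a b c d, L a b c d = -L b a c d) (h34 : ∀ a b c d, L a b c d = -L a b d c)
    (hcyc : ∀ a b c d, L a b c d + L a c d b + L a d b c = 0) (a b c d : ι) :
    L a b c d = L c d a b := by
  linarith [hcyc a b c d, hcyc b c d a, hcyc c d a b, hcyc d a b c,
    h12 a b c d, h12 c d a b, h12 b c d a, h12 d a b c, h12 a c d b, h12 b d a c,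
    h12 c a b d, h12 d b c a, h12 a d b c, h12 b a c d, h12 c b d a, h12 d c a b,
    h34 a b c d, h34 c d a b, h34 b c d a, h34 d a b c, h34 a c d b, h34 b d a c,
    h34 c a b d, h34 d b c a, h34 a d b c, h34 b a c d, h34 c b d a, h34 d c a b]

lemma sum_inv_mul_sum {ι : Type*} [Fintype ι] [DecidableEq ι] {g h : ι → ι → ℝ}
    (hgh : ∀ a b, ∑ m, h a m * g m b = if a = b then 1 else 0) (v : ι → ℝ) (m : ι) :
    ∑ n, h m n * ∑ k, g n k * v k = v m := by
  simp only [Finset.mul_sum, ← mul_assoc]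
  rw [Finset.sum_comm]
  simp only [← Finset.sum_mul, hgh]
  simp

/-- Pointwise form of the contraction of the integrability condition for a Yano tensor. -/
lemma contracted_integrability {ι : Type*} [Fintype ι] [DecidableEq ι]
    {g h y : ι → ι → ℝ} {R S : ι → ι → ι → ι → ℝ}
    (hsymm : ∀ a b, h a b = h b a)
    (hgh : ∀ a b, ∑ m, h a m * g m b = if a = b then 1 else 0)
    (hy : ∀ a b, y a b = -y b a)
    (h12 : ∀ a b c d, ∑ k, g a k * R k b c d = -∑ k, g b k * R k a c d)
    (h34 : ∀ a b c d, R a b c d = -R a b d c)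
    (hcyc : ∀ a b c d, R a b c d + R a c d b + R a d b c = 0)
    (hS : ∀ d c b a, S d c b a = -S d b c a) (hS' : ∀ d c b a, S d c b a = -S d c a b)
    (hSR : ∀ d c b a, S d c b a - S c d b a
      = -(∑ m, R m b d c * y m a) - ∑ m, R m a d c * y b m) (a d : ι) :
    (∑ m, y m a * ∑ n, h m n * ∑ k, R k n k d)
      + ∑ m, y m d * ∑ n, h m n * ∑ k, R k n k a = 0 := by
  set L : ι → ι → ι → ι → ℝ := fun a b c d => ∑ k, g a k * R k b c d with hL
  have hR : ∀ m a c d, R m a c d = ∑ n, h m n * L n a c d := fun m a c d =>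
    (sum_inv_mul_sum hgh (fun k => R k a c d) m).symm
  have L12 : ∀ a b c d, L a b c d = -L b a c d := h12
  have L34 : ∀ a b c d, L a b c d = -L a b d c := fun a b c d => by
    simp only [hL, h34 _ b c d, mul_neg, Finset.sum_neg_distrib]
  have Lcyc : ∀ a b c d, L a b c d + L a c d b + L a d b c = 0 := fun a b c d => by
    simp only [hL, ← Finset.sum_add_distrib, ← mul_add, hcyc, mul_zero, Finset.sum_const_zero]
  have Lpair := pair_symm_of_cyclic L12 L34 Lcyc
  have trace_zero : ∀ d a, ∑ c, ∑ b, h c b * S d c b a = 0 := fun d a => by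
    have : ∑ c, ∑ b, h c b * S d c b a = -∑ c, ∑ b, h c b * S d c b a := by
      conv_lhs => rw [Finset.sum_comm]
      simp only [← Finset.sum_neg_distrib]
      refine Finset.sum_congr rfl fun b _ => Finset.sum_congr rfl fun c _ => ?_
      rw [hsymm, hS]; ring
    linarith
  have div_antisymm : ∀ d a, ∑ c, ∑ b, h c b * S c d b a = -∑ c, ∑ b, h c b * S c a b d :=
    fun d a => by
      simp only [← Finset.sum_neg_distrib]
      refine Finset.sum_congr rfl fun c _ => Finset.sum_congr rfl fun b _ => ?_
      rw [hS c d b a, hS' c b d a, hS c b a d]; ring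
  have ricci_term : ∀ d a, ∑ c, ∑ b, h c b * ∑ m, R m b d c * y m a
      = ∑ m, y m a * ∑ n, h m n * ∑ k, R k n k d := fun d a => by
    have : ∀ m, ∑ c, ∑ b, h c b * R m b d c = ∑ n, h m n * ∑ k, R k n k d := fun m => by
      simp only [hR _ _ _ d, hR m _ d _, Finset.mul_sum]
      calc ∑ c, ∑ b, ∑ n, h c b * (h m n * L n b d c)
          = ∑ c, ∑ n, ∑ b, h c b * (h m n * L n b d c) :=
            Finset.sum_congr rfl fun c _ => Finset.sum_comm
        _ = ∑ n, ∑ c, ∑ b, h c b * (h m n * L n b d c) := Finset.sum_comm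
        _ = _ := Finset.sum_congr rfl fun n _ => Finset.sum_congr rfl fun c _ =>
            Finset.sum_congr rfl fun b _ => by rw [L12, L34]; ring
    simp only [← this]
    simp only [Finset.mul_sum]
    calc ∑ c, ∑ b, ∑ m, h c b * (R m b d c * y m a)
        = ∑ c, ∑ m, ∑ b, h c b * (R m b d c * y m a) :=
          Finset.sum_congr rfl fun c _ => Finset.sum_comm
      _ = ∑ m, ∑ c, ∑ b, h c b * (R m b d c * y m a) := Finset.sum_comm
      _ = _ := Finset.sum_congr rfl fun m _ => Finset.sum_congr rfl fun c _ =>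
          Finset.sum_congr rfl fun b _ => by ring
  have riem_term : ∀ d a, ∑ c, ∑ b, h c b * ∑ m, R m a d c * y b m
      = -∑ c, ∑ b, h c b * ∑ m, R m d a c * y b m := fun d a => by
    have expand : ∀ d a, ∑ c, ∑ b, h c b * ∑ m, R m a d c * y b m
        = ∑ c, ∑ n, ∑ b, ∑ m, h c b * h m n * L n a d c * y b m := fun d a => by
      refine Finset.sum_congr rfl fun c _ => ?_
      rw [Finset.sum_comm]
      refine Finset.sum_congr rfl fun b _ => ?_
      rw [Finset.sum_comm, Finset.mul_sum]
      refine Finset.sum_congr rfl fun m _ => ?_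
      rw [hR, Finset.sum_mul, Finset.mul_sum]
      exact Finset.sum_congr rfl fun n _ => by ring
    rw [expand, expand, Finset.sum_comm]
    simp only [← Finset.sum_neg_distrib]
    refine Finset.sum_congr rfl fun n _ => Finset.sum_congr rfl fun c _ => ?_
    rw [Finset.sum_comm]
    refine Finset.sum_congr rfl fun m _ => Finset.sum_congr rfl fun b _ => ?_
    rw [hy b m, hsymm c b, hsymm m n, Lpair n a d c, L12 d c n a, L34 c d n a]
    ring
  have contracted : ∀ d a, -∑ c, ∑ b, h c b * S c d b a
      = -(∑ m, y m a * ∑ n, h m n * ∑ k, R k n k d)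
        - ∑ c, ∑ b, h c b * ∑ m, R m a d c * y b m := fun d a => by
    rw [← ricci_term, ← zero_sub, ← trace_zero d a]
    simp only [← Finset.sum_sub_distrib, ← Finset.sum_neg_distrib, ← mul_sub, hSR, ← mul_neg]
  linarith [contracted d a, contracted a d, div_antisymm d a, riem_term d a]

theorem yano_anticommutes_with_ricci
    (U : Set Pt) (hU : IsOpen U)
    (Γ : Fin 4 → Fin 4 → Fin 4 → Pt → ℝ)
    (hΓsmooth : ∀ m a b, ContDiffOn ℝ (⊤ : ℕ∞) (Γ m a b) U)
    (hΓsymm : ∀ m a b, ∀ p ∈ U, Γ m a b p = Γ m b a p)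
    (g ginv : Fin 4 → Fin 4 → Pt → ℝ)
    (hgsmooth : ∀ a b, ContDiffOn ℝ (⊤ : ℕ∞) (g a b) U)
    (hgsymm : ∀ a b, ∀ p ∈ U, g a b p = g b a p)
    (hgdet : ∀ p ∈ U, Matrix.det (Matrix.of fun i j => g i j p) < 0)
    (hginv : ∀ p ∈ U, ∀ a b, (∑ m, g a m p * ginv m b p) = if a = b then 1 else 0)
    (hcompat : ∀ p ∈ U, ∀ c a b, cov2 Γ g c a b p = 0)
    (Y : Fin 4 → Fin 4 → Pt → ℝ)
    (hYsmooth : ∀ a b, ContDiffOn ℝ (⊤ : ℕ∞) (Y a b) U)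
    (hYanti : ∀ a b, ∀ p ∈ U, Y a b p = - Y b a p)
    (hYano : ∀ a b c, ∀ p ∈ U, cov2 Γ Y c b a p + cov2 Γ Y b c a p = 0) :
    ∀ p ∈ U, ∀ a b,
      (∑ m, Y m a p * RicUp Γ ginv m b p) + (∑ m, Y m b p * RicUp Γ ginv m a p) = 0 := by
  intro p hp a b
  have hmul : (Matrix.of fun i j => g i j p) * (Matrix.of fun i j => ginv i j p) = 1 := by
    ext i j
    simpa [Matrix.mul_apply, Matrix.one_apply] using hginv p hp i j
  have hmul' := mul_eq_one_comm.1 hmul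
  have hgT : (Matrix.of fun i j => g i j p).transpose = Matrix.of fun i j => g i j p := by
    ext i j
    exact hgsymm j i p hp
  have hinvT : (Matrix.of fun i j => ginv i j p).transpose = Matrix.of fun i j => ginv i j p := by
    refine left_inv_eq_right_inv ?_ hmul
    rw [← hgT, ← Matrix.transpose_mul, hmul, Matrix.transpose_one]
  have cov_anti : ∀ c b a, ∀ q ∈ U, cov2 Γ Y c b a q = -cov2 Γ Y c a b q := by
    intro c b a q hq
    have h1 : ∀ k, Γ k c b q * Y k a q = -(Γ k c b q * Y a k q) := fun k => by
      rw [hYanti k a q hq]; ring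
    have h2 : ∀ k, Γ k c a q * Y b k q = -(Γ k c a q * Y k b q) := fun k => by
      rw [hYanti b k q hq]; ring
    simp only [cov2, pd_congr hU (hYanti b a) c hq, pd_neg, h1, h2, Finset.sum_neg_distrib]
    ring
  have cov_swap : ∀ c b a, ∀ q ∈ U, cov2 Γ Y c b a q = -cov2 Γ Y b c a q := fun c b a q hq =>
    eq_neg_of_add_eq_zero_left (hYano a b c q hq)
  have cov_metric : ∀ d c b a, cov3 Γ (cov2 Γ g) d c b a p = 0 := fun d c b a => by
    have h0 : pd (cov2 Γ g c b a) d p = 0 := by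
      rw [pd_congr hU (h := fun _ => 0) (fun q hq => hcompat q hq c b a) d hp]
      simp [pd]
    simp [cov3, h0, hcompat p hp]
  refine contracted_integrability (g := fun i j => g i j p) (h := fun i j => ginv i j p)
    (y := fun i j => Y i j p) (R := fun i j k l => Riem Γ i j k l p)
    (S := fun d c b a => cov3 Γ (cov2 Γ Y) d c b a p)
    (fun i j => (congrFun (congrFun hinvT i) j).symm)
    (fun i j => by simpa [Matrix.mul_apply, Matrix.one_apply] using congrFun (congrFun hmul' i) j)
    (fun i j => hYanti i j p hp) (fun i j k l => ?_) (fun i j k l => riem_swap Γ i j k l p)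
    (fun i j k l => riem_cyclic hU hΓsymm i j k l hp)
    (fun d c b a => cov3_swap_left hU Γ cov_swap d c b a hp)
    (fun d c b a => cov3_swap_right hU Γ cov_anti d c b a hp)
    (fun d c b a => ricci_identity hU hΓsmooth hΓsymm hYsmooth d c b a hp) a b
  have h := ricci_identity hU hΓsmooth hΓsymm hgsmooth k l j i hp
  simp only [cov_metric, fun m => hgsymm m i p hp, mul_comm (Riem Γ _ _ _ _ p)] at h
  linarith
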